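/- Let N ≥ 1, let μ₁, …, μ_N be real numbers and σ₁, …, σ_N positive real numbers, and let X₁, …, X_N be independent random variables with X_i normally distributed with mean μ_i and variance σ_i². Call index i a success if X_i > μ_i; a success run is a maximal block of consecutive success indices A, with weight χ²_run(A) = Σ_{i∈A} (X_i − μ_i)²/σ_i², and T = max over success runs of these weights. Then for every real t > 0, the probability of the event that at least one success occurs and T < t equals 2^{−N} · Σ_{r=1}^{N} Σ_{M=1}^{min(r, N−r+1)} Σ_{π} [∏_l F_l(t)^{n_l}] · (N − r + 2 − M)_M / ∏_l n_l!, where the inner sum runs over all partitions π of r into exactly M parts, n_l is the number of parts of π equal to l, (x)_n = x(x+1)···(x+n−1), and F_l(t) = γ(l/2, t/2)/Γ(l/2) is the cumulative distribution function at t of the chi-squared distribution with l degrees of freedom. -/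

import Mathlib

open MeasureTheory ProbabilityTheory

/-- `IsSuccessRun succ A` says that the finite set `A` of indices is a success run for the
success predicate `succ`: `A` is a nonempty maximal block of consecutive success indices,
i.e. `A` is nonempty, consists of successes, is an interval of consecutive indices, and
cannot be extended by an adjacent success index. -/
def IsSuccessRun {N : ℕ} (succ : Fin N → Prop) (A : Finset (Fin N)) : Prop :=
  A.Nonempty ∧ (∀ i ∈ A, succ i) ∧
    (∀ i ∈ A, ∀ j ∈ A, ∀ k, i ≤ k → k ≤ j → k ∈ A) ∧
    (∀ i : Fin N, succ i → (∃ j ∈ A, (i : ℕ) + 1 = (j : ℕ) ∨ (j : ℕ) + 1 = (i : ℕ)) → i ∈ A)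

/-- `F l t = γ(l/2, t/2) / Γ(l/2)`: the cumulative distribution function at `t` of the
chi-squared distribution with `l` degrees of freedom, where
`γ(a, x) = ∫₀ˣ s^{a-1} e^{-s} ds` is the lower incomplete gamma function. -/
noncomputable def chiSqCDF (l : ℕ) (t : ℝ) : ℝ :=
  (∫ s in (0 : ℝ)..(t / 2), s ^ ((l : ℝ) / 2 - 1) * Real.exp (-s)) / Real.Gamma ((l : ℝ) / 2)

section Partitions

open Finset

open Polynomial in
lemma Polynomial.multiset_map_monomial_prod (f : ℕ → ℝ) (s : Multiset ℕ) :
    (s.map fun l => monomial l (f l)).prod = monomial s.sum (s.map f).prod := by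
  induction s using Multiset.induction with
  | empty => simp
  | cons a s ih => simp [ih, monomial_mul_monomial]

lemma Multiset.countPerms_mul_prod_factorial (s : Multiset ℕ) (t : Finset ℕ)
    (ht : ∀ l ∈ s, l ∈ t) :
    s.countPerms * ∏ l ∈ t, (s.count l).factorial = (Multiset.card s).factorial := by
  have h := Nat.multinomial_spec s.toFinset (fun l => s.count l)
  rw [Multiset.toFinset_sum_count_eq] at h
  rw [← h, mul_comm]
  have h2 : ∏ l ∈ s.toFinset, (s.count l).factorial = ∏ l ∈ t, (s.count l).factorial := by
    apply Finset.prod_subset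
    · intro l hl
      exact ht l (Multiset.mem_toFinset.1 hl)
    · intro l _ hl
      rw [Multiset.mem_toFinset] at hl
      simp [Multiset.count_eq_zero_of_notMem hl]
  rw [h2]
  rfl

open Polynomial in
lemma coeff_pow_eq_sum_partition (N M r : ℕ) (hr : r ≤ N) (f : ℕ → ℝ) :
    ((∑ l ∈ Icc 1 N, monomial l (f l)) ^ M).coeff r =
      ∑ π ∈ univ.filter (fun π : Nat.Partition r => Multiset.card π.parts = M),
        (M.factorial : ℝ) * (∏ l ∈ Icc 1 r, f l ^ π.parts.count l) /
          ∏ l ∈ Icc 1 r, ((π.parts.count l).factorial : ℝ) := by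
  rw [Finset.sum_pow, Polynomial.finsetSum_coeff]
  have key : ∀ k ∈ (Icc 1 N).sym M,
      ((k.val.countPerms : ℝ[X]) * (k.val.map fun l => monomial l (f l)).prod).coeff r =
        if k.val.sum = r then (k.val.countPerms : ℝ) * (k.val.map f).prod else 0 := by
    intro k _
    rw [multiset_map_monomial_prod, ← C_eq_natCast, coeff_C_mul, coeff_monomial, mul_ite, mul_zero]
  rw [Finset.sum_congr rfl key, ← Finset.sum_filter]
  symm
  refine Finset.sum_bij (fun π hπ => ⟨π.parts, (Finset.mem_filter.1 hπ).2⟩) ?_ ?_ ?_ ?_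
  · intro π hπ
    refine Finset.mem_filter.2 ⟨Finset.mem_sym_iff.2 fun l hl => ?_, π.parts_sum⟩
    have := Multiset.single_le_sum (fun _ _ => Nat.zero_le _) l hl
    rw [π.parts_sum] at this
    exact Finset.mem_Icc.2 ⟨π.parts_pos hl, this.trans hr⟩
  · intro π _ π' _ h
    exact Nat.Partition.ext (Subtype.ext_iff.1 h)
  · intro k hk
    rw [Finset.mem_filter, Finset.mem_sym_iff] at hk
    exact ⟨⟨k.val, fun {i} hi => (Finset.mem_Icc.1 (hk.1 i hi)).1, hk.2⟩, by simp, rfl⟩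
  · intro π hπ
    have hmem : ∀ l ∈ π.parts, l ∈ Icc 1 r := by
      intro l hl
      have := Multiset.single_le_sum (fun _ _ => Nat.zero_le _) l hl
      rw [π.parts_sum] at this
      exact Finset.mem_Icc.2 ⟨π.parts_pos hl, this⟩
    have h1 := Multiset.countPerms_mul_prod_factorial π.parts _ hmem
    rw [(Finset.mem_filter.1 hπ).2] at h1
    have h2 : (π.parts.map f).prod = ∏ l ∈ Icc 1 r, f l ^ π.parts.count l := by
      rw [Finset.prod_multiset_map_count]
      apply Finset.prod_subset
      · intro l hl
        exact hmem l (Multiset.mem_toFinset.1 hl)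
      · intro l _ hl
        rw [Multiset.mem_toFinset] at hl
        simp [Multiset.count_eq_zero_of_notMem hl]
    have h3 : (∏ l ∈ Icc 1 r, ((π.parts.count l).factorial : ℝ)) ≠ 0 :=
      Finset.prod_ne_zero_iff.2 fun l _ => by positivity
    simp only [h2]
    rw [div_eq_iff h3, ← h1]
    push_cast
    ring

open Polynomial in
/-- `∑ j ≤ n, [X ^ (n - j)] F ^ j`: the total weight of the compositions of `n` into positive
parts, where a part `k + 1` has weight `F.coeff k`. -/
noncomputable def blockSum (F : ℝ[X]) (n : ℕ) : ℝ :=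
  ∑ j ∈ range (n + 1), (F ^ j).coeff (n - j)

open Polynomial in
lemma blockSum_succ (F : ℝ[X]) (n : ℕ) :
    blockSum F (n + 1) = ∑ k ∈ range (n + 1), F.coeff k * blockSum F (n - k) := by
  unfold blockSum
  rw [Finset.sum_range_succ']
  simp only [Nat.add_sub_add_right, pow_zero, Nat.sub_zero, coeff_one, Nat.succ_ne_zero, pow_succ',
    coeff_mul, Finset.Nat.sum_antidiagonal_eq_sum_range_succ_mk, if_false, add_zero,
    Finset.mul_sum]
  rw [Finset.sum_sigma', Finset.sum_sigma']
  refine Finset.sum_bij' (fun a _ => ⟨a.2, a.1⟩) (fun a _ => ⟨a.2, a.1⟩) ?_ ?_ ?_ ?_ ?_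
  · simp; grind
  · simp; grind
  · simp
  · simp
  · rintro ⟨a, b⟩ _
    simp only
    rw [Nat.sub_right_comm]

open Polynomial in
lemma blockSum_one_add (N : ℕ) (f : ℕ → ℝ) :
    blockSum (1 + ∑ l ∈ Icc 1 N, monomial l (f l)) (N + 1) = 1 +
      ∑ r ∈ Icc 1 N, ∑ M ∈ Icc 1 (min r (N - r + 1)),
        ∑ π ∈ univ.filter (fun π : Nat.Partition r => Multiset.card π.parts = M),
          (∏ l ∈ Icc 1 r, f l ^ (π.parts.count l))
            * Polynomial.eval ((N : ℝ) - r + 2 - M) (ascPochhammer ℝ M)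
            / ∏ l ∈ Icc 1 r, (Nat.factorial (π.parts.count l) : ℝ) := by
  set g : ℝ[X] := ∑ l ∈ Icc 1 N, monomial l (f l) with hg
  have g0 : g.coeff 0 = 0 := by
    rw [hg, finsetSum_coeff]
    refine Finset.sum_eq_zero fun l hl => ?_
    rw [coeff_monomial, if_neg]
    have := (Finset.mem_Icc.1 hl).1
    omega
  unfold blockSum
  rw [← Finset.sum_range_reflect, Finset.sum_range_succ, Finset.range_eq_Ico,
    Finset.sum_eq_sum_Ico_succ_bot (by omega)]
  simp only [Nat.add_sub_cancel, Nat.sub_self, pow_zero, Nat.sub_zero, Nat.zero_add]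
  have h0 : ((1 + g) ^ (N + 1)).coeff 0 = 1 := by
    simp [coeff_zero_eq_eval_zero] at g0 ⊢
    simp [g0]
  rw [h0, coeff_one, if_neg (by omega), add_zero]
  congr 1
  refine Finset.sum_congr rfl fun r hr => ?_
  have hr' := Finset.mem_Ico.1 hr
  rw [show N + 1 - r = N - r + 1 by omega, show N + 1 - (N - r + 1) = r by omega,
    add_comm 1 g, add_pow, finsetSum_coeff]
  simp only [one_pow, mul_one]
  rw [Finset.sum_range_succ']
  have z : (g ^ 0 * ((N - r + 1).choose 0 : ℝ[X])).coeff r = 0 := by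
    simp [coeff_one]; omega
  rw [z, add_zero]
  rw [Finset.range_eq_Ico, Finset.sum_Ico_add'
    (fun M => (g ^ M * ((N - r + 1).choose M : ℝ[X])).coeff r) 0 (N - r + 1) 1]
  symm
  have : ∀ M, (g ^ M * ((N - r + 1).choose M : ℝ[X])).coeff r =
        ∑ π ∈ univ.filter (fun π : Nat.Partition r => Multiset.card π.parts = M),
          (∏ l ∈ Icc 1 r, f l ^ (π.parts.count l))
            * (((N - r + 1).choose M : ℝ) * M.factorial)
            / ∏ l ∈ Icc 1 r, (Nat.factorial (π.parts.count l) : ℝ) := by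
    intro M
    rw [← C_eq_natCast, coeff_mul_C, coeff_pow_eq_sum_partition N M r (by omega), Finset.sum_mul]
    refine Finset.sum_congr rfl fun π _ => ?_
    ring
  rw [Finset.sum_congr rfl (fun M _ => this M)]
  refine (Finset.sum_congr rfl ?_).trans (Finset.sum_subset ?_ ?_)
  · intro M hM
    refine Finset.sum_congr rfl fun π _ => ?_
    congr 2
    have hM' := Finset.mem_Icc.1 hM
    have e : (N : ℝ) - r + 2 - M = ((N - r + 2 - M : ℕ) : ℝ) := by
      rw [Nat.cast_sub (by omega), Nat.cast_add, Nat.cast_sub (by omega)]; simp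
    rw [e, ascPochhammer_nat_eq_natCast_descFactorial,
      show N - r + 2 - M + M - 1 = N - r + 1 by omega, Nat.descFactorial_eq_factorial_mul_choose]
    push_cast
    ring
  · intro M hM
    simp at hM ⊢
    omega
  · intro M hM hM'
    apply Finset.sum_eq_zero
    intro π hπ
    exfalso
    have h1 : Multiset.card π.parts ≤ r := by
      have := Multiset.card_nsmul_le_sum (s := π.parts) (a := 1) (fun x hx => π.parts_pos hx)
      rw [π.parts_sum] at this
      simpa using this
    rw [(Finset.mem_filter.1 hπ).2] at h1
    simp at hM hM'
    omega

end Partitions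

section ChiSquared

open Set Filter Topology

lemma MeasureTheory.Measure.ext_of_mgf_eqOn_Iio {μ ν : Measure ℝ} [IsFiniteMeasure μ]
    [IsFiniteMeasure ν] {c : ℝ} (hc : 0 < c) (h : ∀ s < c, mgf id μ s = mgf id ν s)
    (hpos : ∀ s < c, 0 < mgf id ν s) : μ = ν := by
  have hint : ∀ ρ : Measure ℝ, (∀ s < c, 0 < mgf id ρ s) →
      Iio c ⊆ interior (integrableExpSet id ρ) := by
    intro ρ hρ
    refine interior_maximal (fun s hs => ?_) isOpen_Iio
    by_contra hn
    exact (hρ s hs).ne' (mgf_undef hn)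
  have hμ := hint μ fun s hs => (h s hs).symm ▸ hpos s hs
  have hν := hint ν hpos
  have key : EqOn (complexMGF id μ) (complexMGF id ν) {z | z.re ∈ Iio c} := by
    refine AnalyticOnNhd.eqOn_of_preconnected_of_frequently_eq
      (analyticOnNhd_complexMGF.mono fun z hz => hμ hz)
      (analyticOnNhd_complexMGF.mono fun z hz => hν hz)
      ((convex_Iio c).linear_preimage Complex.reLm).isPreconnected
      (z₀ := ((0 : ℝ) : ℂ)) (by simpa using hc) ?_
    have h_real : ∃ᶠ x : ℝ in 𝓝[≠] 0, complexMGF id μ x = complexMGF id ν x := by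
      refine Eventually.frequently ?_
      filter_upwards [mem_nhdsWithin_of_mem_nhds (Iio_mem_nhds hc)] with x hx
      rw [complexMGF_ofReal, complexMGF_ofReal, h x hx]
    have ht : Tendsto (fun x : ℝ => (x : ℂ)) (𝓝[≠] 0) (𝓝[≠] ((0 : ℝ) : ℂ)) :=
      tendsto_nhdsWithin_iff.2 ⟨(Complex.continuous_ofReal.tendsto 0).mono_left nhdsWithin_le_nhds,
        by filter_upwards [self_mem_nhdsWithin] with x hx using by simpa using hx⟩
    exact ht.frequently h_real
  refine Measure.ext_of_charFun (funext fun s => ?_)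
  rw [← complexMGF_id_mul_I, ← complexMGF_id_mul_I]
  exact key (by simpa using hc)

lemma mgf_id_gammaMeasure {a r s : ℝ} (ha : 0 < a) (hr : 0 < r) (hs : s < r) :
    mgf id (gammaMeasure a r) s = (r / (r - s)) ^ a := by
  have hG := Real.Gamma_pos_of_pos ha
  rw [mgf, gammaMeasure, integral_withDensity_eq_integral_toReal_smul (by unfold gammaPDF; fun_prop)
    (ae_of_all _ fun x => by simp [gammaPDF])]
  have : ∀ x, (gammaPDF a r x).toReal • Real.exp (s * id x) =
      (Ici 0).indicator (fun x => r ^ a / Real.Gamma a *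
        (x ^ (a - 1) * Real.exp (-((r - s) * x)))) x := by
    intro x
    rw [gammaPDF, ENNReal.toReal_ofReal (gammaPDFReal_nonneg ha hr x), gammaPDFReal, indicator]
    simp only [mem_Ici, smul_eq_mul, id]
    split_ifs with hx
    · rw [mul_assoc, mul_assoc, ← Real.exp_add]; ring_nf
    · simp
  simp_rw [this]
  rw [integral_indicator measurableSet_Ici, integral_Ici_eq_integral_Ioi, integral_const_mul,
    Real.integral_rpow_mul_exp_neg_mul_Ioi ha (by linarith), Real.div_rpow hr.le (by linarith),
    Real.div_rpow zero_le_one (by linarith), Real.one_rpow]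
  field_simp

lemma gammaMeasure_half_Iio {k : ℕ} (hk : k ≠ 0) {t : ℝ} (ht : 0 < t) :
    (gammaMeasure ((k : ℝ) / 2) (1 / 2)).real (Iio t) =
      (∫ s in (0 : ℝ)..(t / 2), s ^ ((k : ℝ) / 2 - 1) * Real.exp (-s)) / Real.Gamma ((k : ℝ) / 2) := by
  have ha : (0 : ℝ) < (k : ℝ) / 2 := by positivity
  have hG := Real.Gamma_pos_of_pos ha
  set a : ℝ := (k : ℝ) / 2 with hadef
  rw [measureReal_def, gammaMeasure, withDensity_apply _ measurableSet_Iio]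
  rw [show (∫⁻ x in Iio t, gammaPDF a (1 / 2) x).toReal =
    ∫ x in Iio t, gammaPDFReal a (1 / 2) x from ?_]
  · have : ∀ x, gammaPDFReal a (1 / 2) x = (Ici 0).indicator (fun x => (1 / 2) ^ a / Real.Gamma a *
        x ^ (a - 1) * Real.exp (-(1/2 * x))) x := by
      intro x
      simp [gammaPDFReal, indicator]
    simp_rw [this]
    rw [setIntegral_indicator measurableSet_Ici, inter_comm, Ici_inter_Iio,
      integral_Ico_eq_integral_Ioo, ← integral_Ioc_eq_integral_Ioo,
      ← intervalIntegral.integral_of_le ht.le]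
    have e := intervalIntegral.integral_comp_mul_left
      (a := 0) (b := t) (fun s : ℝ => s ^ (a - 1) * Real.exp (-s)) (c := 1 / 2) (by norm_num)
    simp only [mul_zero, smul_eq_mul] at e
    rw [show (1 / 2 * t : ℝ) = t / 2 by ring] at e
    rw [eq_div_iff hG.ne', ← intervalIntegral.integral_mul_const]
    have e2 : (∫ s in (0 : ℝ)..(t / 2), s ^ (a - 1) * Real.exp (-s)) =
      (1 / 2) * ∫ x in (0 : ℝ)..t, (1 / 2 * x) ^ (a - 1) * Real.exp (-(1 / 2 * x)) := by
      rw [e]; ring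
    rw [e2, ← intervalIntegral.integral_const_mul]
    refine intervalIntegral.integral_congr fun x hx => ?_
    rw [uIcc_of_le ht.le] at hx
    rw [Real.mul_rpow (by norm_num) hx.1]
    rw [show ((1 : ℝ) / 2)^a = (1 / 2) * (1 / 2) ^ (a-1) by
      rw [Real.rpow_sub_one (by norm_num)]; ring]
    field_simp
  · exact (integral_eq_lintegral_of_nonneg_ae
      (ae_of_all _ fun x => gammaPDFReal_nonneg ha (by norm_num) x) (by fun_prop)).symm

lemma integral_indicator_exp_sq_gaussianReal {s : ℝ} (hs : s < 1 / 2) :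
    ∫ z, (Ioi (0 : ℝ)).indicator (fun z => Real.exp (s * z ^ 2)) z ∂(gaussianReal 0 1) =
      (1 / 2) * ((1 / 2) / (1 / 2 - s)) ^ (1 / 2 : ℝ) := by
  rw [integral_gaussianReal_eq_integral_smul (by simp)]
  have : ∀ z, gaussianPDFReal 0 1 z • (Ioi (0 : ℝ)).indicator (fun z => Real.exp (s * z ^ 2)) z =
     (Ioi (0 : ℝ)).indicator (fun z => (√(2 * Real.pi))⁻¹ * Real.exp (-(1/2 - s) * z ^ 2)) z := by
    intro z
    simp only [indicator, smul_eq_mul, gaussianPDFReal]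
    split_ifs
    · rw [mul_assoc, ← Real.exp_add]; simp; left; ring
    · simp
  simp_rw [this]
  rw [integral_indicator measurableSet_Ioi, integral_const_mul, integral_gaussian_Ioi,
    ← Real.sqrt_eq_rpow, ← Real.sqrt_inv, mul_div_assoc', ← Real.sqrt_mul (by positivity)]
  have : (2 * Real.pi)⁻¹ * (Real.pi / (1/2 - s)) = (1 / 2)/(1/2 - s) := by
    have : (1/2 - s) ≠ 0 := by linarith
    have := Real.pi_pos.ne'
    field_simp
  rw [this]; ring

lemma measureReal_orthant_sum_sq_lt {ι Ω : Type*} [Fintype ι] {mΩ : MeasurableSpace Ω} {P : Measure Ω}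
    [IsProbabilityMeasure P] {Z : ι → Ω → ℝ} (hm : ∀ i, Measurable (Z i)) (hind : iIndepFun Z P)
    (hlaw : ∀ i, P.map (Z i) = gaussianReal 0 1) (A : Finset ι) (hA : A.card ≠ 0) {t : ℝ}
    (ht : 0 < t) :
    P.real {ω | (∀ i ∈ A, 0 < Z i ω) ∧ ∑ i ∈ A, Z i ω ^ 2 < t} =
      (1 / 2) ^ A.card * ((∫ s in (0 : ℝ)..(t / 2), s ^ ((A.card : ℝ) / 2 - 1) * Real.exp (-s)) /
        Real.Gamma ((A.card : ℝ) / 2)) := by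
  classical
  have hS : MeasurableSet {ω | ∀ i ∈ A, 0 < Z i ω} := by
    simp only [ofPred_forall]
    exact Finset.measurableSet_biInter A fun i _ => measurableSet_lt measurable_const (hm i)
  have hY : Measurable fun ω => ∑ i ∈ A, Z i ω ^ 2 := by fun_prop
  have ha : (0 : ℝ) < (A.card : ℝ) / 2 := by positivity
  have := isProbabilityMeasure_gammaMeasure ha (r := 1/2) (by norm_num)
  have hmgf : ∀ s < (1 / 2 : ℝ),
      mgf id ((P.restrict {ω | ∀ i ∈ A, 0 < Z i ω}).map fun ω => ∑ i ∈ A, Z i ω ^ 2) s =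
        (1 / 2) ^ A.card * ((1 / 2) / (1 / 2 - s)) ^ ((A.card : ℝ) / 2) := by
    intro s hs
    rw [mgf, integral_map hY.aemeasurable (by fun_prop), ← integral_indicator hS]
    have : ∀ ω, {ω | ∀ i ∈ A, 0 < Z i ω}.indicator
        (fun ω => Real.exp (s * id (∑ i ∈ A, Z i ω ^ 2))) ω =
        ∏ i, (if i ∈ A then (Ioi (0 : ℝ)).indicator (fun z => Real.exp (s * z ^ 2))
          else fun _ => 1) (Z i ω) := by
      intro ω
      have e : ∏ i, (if i ∈ A then (Ioi (0 : ℝ)).indicator (fun z => Real.exp (s * z ^ 2))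
          else fun _ => 1) (Z i ω) =
          ∏ i ∈ A, (Ioi (0 : ℝ)).indicator (fun z => Real.exp (s * z ^ 2)) (Z i ω) := by
        rw [← Finset.prod_subset (Finset.subset_univ A)]
        · exact Finset.prod_congr rfl fun i hi => by rw [if_pos hi]
        · intro i _ hi
          rw [if_neg hi]
      rw [e]
      by_cases h : ∀ i ∈ A, 0 < Z i ω
      · rw [indicator_of_mem (by exact h), id, Finset.mul_sum, Real.exp_sum]
        exact Finset.prod_congr rfl fun i hi => by rw [indicator_of_mem (by exact h i hi)]
      · rw [indicator_of_notMem (by exact h)]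
        push Not at h
        obtain ⟨i, hi, hi'⟩ := h
        exact (Finset.prod_eq_zero hi (indicator_of_notMem (s := Ioi (0 : ℝ)) hi'.not_gt _)).symm
    simp_rw [this]
    have hmeas : ∀ i, Measurable (if i ∈ A then (Ioi (0 : ℝ)).indicator
        (fun z => Real.exp (s * z ^ 2)) else fun _ => 1) := by
      intro i
      split_ifs
      · exact Measurable.indicator (by fun_prop) measurableSet_Ioi
      · fun_prop
    rw [hind.integral_fun_prod_comp (fun i => (hm i).aemeasurable)
      (fun i => (hmeas i).aestronglyMeasurable)]
    have e : ∀ i, ∫ ω, (if i ∈ A then (Ioi (0 : ℝ)).indicator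
        (fun z => Real.exp (s * z ^ 2)) else fun _ => 1) (Z i ω) ∂P =
        if i ∈ A then (1 / 2) * ((1 / 2) / (1 / 2 - s)) ^ (1 / 2 : ℝ) else 1 := by
      intro i
      rw [← integral_map (hm i).aemeasurable (hmeas i).aestronglyMeasurable, hlaw]
      split_ifs
      · exact integral_indicator_exp_sq_gaussianReal hs
      · simp
    simp_rw [e]
    rw [Finset.prod_ite_mem, Finset.univ_inter, Finset.prod_const, mul_pow, ← Real.rpow_natCast
      (_ ^ (1 / 2 : ℝ)), ← Real.rpow_mul (by apply div_nonneg <;> linarith)]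
    congr 2
    ring
  have hmgf2 : ∀ s < (1 / 2 : ℝ),
      mgf id ((ENNReal.ofReal ((1 / 2) ^ A.card)) • gammaMeasure ((A.card : ℝ) / 2) (1 / 2)) s =
        (1 / 2) ^ A.card * ((1 / 2) / (1 / 2 - s)) ^ ((A.card : ℝ) / 2) := by
    intro s hs
    rw [← mgf_id_gammaMeasure ha (by norm_num) hs, mgf, mgf, integral_smul_measure,
      ENNReal.toReal_ofReal (by positivity), smul_eq_mul]
  have := (gammaMeasure ((A.card : ℝ) / 2) (1 / 2)).smul_finite
    (ENNReal.ofReal_ne_top (r := (1 / 2) ^ A.card))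
  have hEq := Measure.ext_of_mgf_eqOn_Iio (c := 1 / 2)
    (μ := (P.restrict {ω | ∀ i ∈ A, 0 < Z i ω}).map fun ω => ∑ i ∈ A, Z i ω ^ 2)
    (ν := (ENNReal.ofReal ((1 / 2) ^ A.card)) • gammaMeasure ((A.card : ℝ) / 2) (1 / 2))
    (by norm_num) (fun s hs => by rw [hmgf s hs, hmgf2 s hs]) (fun s hs => by
      have : 0 < 1 / 2 - s := by linarith
      rw [hmgf2 s hs]; positivity)
  have h1 := congrArg (fun m : Measure ℝ => (m (Iio t)).toReal) hEq
  rw [Measure.map_apply hY measurableSet_Iio, Measure.restrict_apply (hY measurableSet_Iio),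
    Measure.smul_apply, smul_eq_mul, ENNReal.toReal_mul, ENNReal.toReal_ofReal (by positivity),
    ← measureReal_def, ← measureReal_def, gammaMeasure_half_Iio hA ht] at h1
  rw [← h1, inter_comm]
  rfl

end ChiSquared

/-- `RunsLt t a z`: every block of consecutive indices `≥ a` on which `z` is positive has
sum of squares less than `t`. -/
def RunsLt {N : ℕ} (t : ℝ) (a : ℕ) (z : Fin N → ℝ) : Prop :=
  ∀ B : Finset (Fin N), (∀ i ∈ B, a ≤ (i : ℕ)) → (∀ i ∈ B, 0 < z i) →
    (∀ i ∈ B, ∀ j ∈ B, ∀ k, i ≤ k → k ≤ j → k ∈ B) → ∑ i ∈ B, z i ^ 2 < t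

/-- The indices `i : Fin N` with `a ≤ i < b`. -/
def finSegment (N a b : ℕ) : Finset (Fin N) :=
  Finset.univ.filter fun i => a ≤ (i : ℕ) ∧ (i : ℕ) < b

lemma mem_finSegment {N a b : ℕ} {i : Fin N} :
    i ∈ finSegment N a b ↔ a ≤ (i : ℕ) ∧ (i : ℕ) < b := by
  simp [finSegment]

lemma card_finSegment {N a b : ℕ} (hb : b ≤ N) : (finSegment N a b).card = b - a := by
  rw [← Nat.card_Ico, ← Finset.card_map Fin.valEmbedding]
  congr 1
  ext i
  simp only [Finset.mem_map, mem_finSegment, Fin.valEmbedding_apply, Finset.mem_Ico]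
  exact ⟨fun ⟨j, hj, e⟩ => e ▸ hj, fun h => ⟨⟨i, by omega⟩, h, rfl⟩⟩

lemma exists_isSuccessRun_superset {N : ℕ} {succ : Fin N → Prop} {B : Finset (Fin N)}
    (hne : B.Nonempty) (hB : ∀ i ∈ B, succ i)
    (hc : ∀ i ∈ B, ∀ j ∈ B, ∀ k, i ≤ k → k ≤ j → k ∈ B) :
    ∃ A, IsSuccessRun succ A ∧ B ⊆ A := by
  classical
  obtain ⟨c, hcB⟩ := hne
  refine ⟨Finset.univ.filter fun k => ∀ j, min c k ≤ j → j ≤ max c k → succ j,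
    ⟨⟨c, ?_⟩, ?_, ?_, ?_⟩, ?_⟩
  · simp only [Finset.mem_filter, Finset.mem_univ, true_and, min_self, max_self]
    exact fun j h1 h2 => le_antisymm h1 h2 ▸ hB c hcB
  · intro i hi
    exact (Finset.mem_filter.1 hi).2 i (min_le_right _ _) (le_max_right _ _)
  · intro i hi j hj k hik hkj
    simp only [Finset.mem_filter, Finset.mem_univ, true_and] at hi hj ⊢
    intro l h1 h2
    rcases le_total l c with h | h
    · refine hi l (le_trans ?_ h1) (h.trans (le_max_left _ _))
      exact min_le_min le_rfl hik
    · refine hj l ((min_le_left _ _).trans h) (h2.trans ?_)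
      exact max_le_max le_rfl hkj
  · rintro i hi ⟨j, hj, hij⟩
    simp only [Finset.mem_filter, Finset.mem_univ, true_and] at hj ⊢
    intro l h1 h2
    by_cases hl : l = i
    · exact hl ▸ hi
    · apply hj <;> grind
  · intro k hk
    simp only [Finset.mem_filter, Finset.mem_univ, true_and]
    intro j h1 h2
    rcases le_total c k with h | h
    · exact hB j (hc c hcB k hk j (by simpa [h] using h1) (by simpa [h] using h2))
    · exact hB j (hc k hk c hcB j (by simpa [h] using h1) (by simpa [h] using h2))

lemma forall_isSuccessRun_iff_runsLt {N : ℕ} {t : ℝ} (ht : 0 < t) (z : Fin N → ℝ) :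
    (∀ A, IsSuccessRun (fun i => 0 < z i) A → ∑ i ∈ A, z i ^ 2 < t) ↔ RunsLt t 0 z := by
  constructor
  · intro h B _ hB hc
    rcases B.eq_empty_or_nonempty with rfl | hne
    · simpa using ht
    · obtain ⟨A, hA, hBA⟩ := exists_isSuccessRun_superset hne hB hc
      exact (Finset.sum_le_sum_of_subset_of_nonneg hBA fun i _ _ => sq_nonneg _).trans_lt (h A hA)
  · exact fun h A hA => h A (fun _ _ => Nat.zero_le _) hA.2.1 hA.2.2.1

lemma runsLt_of_le {N : ℕ} {t : ℝ} (ht : 0 < t) {a : ℕ} (ha : N ≤ a) (z : Fin N → ℝ) :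
    RunsLt t a z := by
  intro B hB _ _
  have : B = ∅ := Finset.eq_empty_of_forall_notMem fun i hi => by
    have := hB i hi
    omega
  simpa [this] using ht

lemma runsLt_iff_of_first_failure {N : ℕ} {t : ℝ} {a b : ℕ} (hab : a ≤ b) {z : Fin N → ℝ}
    (hs : ∀ i ∈ finSegment N a b, 0 < z i) (hf : ∀ i : Fin N, (i : ℕ) = b → ¬ 0 < z i) :
    RunsLt t a z ↔ ∑ i ∈ finSegment N a b, z i ^ 2 < t ∧ RunsLt t (b + 1) z := by
  constructor
  · intro h
    refine ⟨h _ (fun i hi => (mem_finSegment.1 hi).1) hs ?_, fun B hB => h B ?_⟩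
    · intro i hi j hj k hik hkj
      rw [mem_finSegment] at *
      have : (i : ℕ) ≤ k := hik
      have : (k : ℕ) ≤ j := hkj
      omega
    · intro i hi
      have := hB i hi
      omega
  · rintro ⟨h1, h2⟩ B hB hp hc
    by_cases hlt : ∃ i ∈ B, (i : ℕ) < b
    · obtain ⟨i, hi, hib⟩ := hlt
      refine (Finset.sum_le_sum_of_subset_of_nonneg ?_ fun i _ _ => sq_nonneg _).trans_lt h1
      intro j hj
      rw [mem_finSegment]
      refine ⟨hB j hj, ?_⟩
      by_contra hjb
      push Not at hjb
      have hbN : b < N := by omega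
      exact hf ⟨b, hbN⟩ rfl (hp _ (hc i hi j hj ⟨b, hbN⟩ hib.le hjb))
    · push Not at hlt
      refine h2 B (fun i hi => ?_) hp hc
      have h3 := hlt i hi
      have h4 : (i : ℕ) ≠ b := fun e => hf i e (hp i hi)
      omega

section Measurability

variable {Ω : Type*} [MeasurableSpace Ω] {N : ℕ} {Z : Fin N → Ω → ℝ}

lemma measurableSet_forall_pos {A : Finset (Fin N)} (h : ∀ i ∈ A, Measurable (Z i)) :
    MeasurableSet {ω | ∀ i ∈ A, 0 < Z i ω} := by
  simp only [Set.ofPred_forall]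
  exact Finset.measurableSet_biInter A fun i hi => measurableSet_lt measurable_const (h i hi)

lemma measurableSet_sum_sq_lt {A : Finset (Fin N)} (h : ∀ i ∈ A, Measurable (Z i)) (t : ℝ) :
    MeasurableSet {ω | ∑ i ∈ A, Z i ω ^ 2 < t} :=
  measurableSet_lt (Finset.measurable_fun_sum A fun i hi => (h i hi).pow_const 2) measurable_const

lemma measurableSet_runsLt {a : ℕ} (h : ∀ i : Fin N, a ≤ (i : ℕ) → Measurable (Z i)) (t : ℝ) :
    MeasurableSet {ω | RunsLt t a fun i => Z i ω} := by
  simp only [RunsLt, Set.ofPred_forall]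
  refine MeasurableSet.iInter fun B => MeasurableSet.iInter fun hB => ?_
  have hm : ∀ i ∈ B, Measurable (Z i) := fun i hi => h i (hB i hi)
  have hset : {ω | (∀ i ∈ B, 0 < Z i ω) →
      (∀ i ∈ B, ∀ j ∈ B, ∀ k, i ≤ k → k ≤ j → k ∈ B) → ∑ i ∈ B, Z i ω ^ 2 < t} =
      {ω | ∀ i ∈ B, 0 < Z i ω}ᶜ ∪
        ⋂ (_ : ∀ i ∈ B, ∀ j ∈ B, ∀ k, i ≤ k → k ≤ j → k ∈ B), {ω | ∑ i ∈ B, Z i ω ^ 2 < t} := by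
    ext ω
    simp only [Set.mem_ofPred_eq, Set.mem_union, Set.mem_compl_iff, Set.mem_iInter]
    tauto
  have := (measurableSet_forall_pos hm).compl.union
    (MeasurableSet.iInter fun _ : ∀ i ∈ B, ∀ j ∈ B, ∀ k, i ≤ k → k ≤ j → k ∈ B =>
      measurableSet_sum_sq_lt hm t)
  rw [← hset] at this
  exact this

lemma measurableSet_not_pos_at {b : ℕ} (h : ∀ i : Fin N, (i : ℕ) = b → Measurable (Z i)) :
    MeasurableSet {ω | ∀ i : Fin N, (i : ℕ) = b → ¬ 0 < Z i ω} := by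
  simp only [Set.ofPred_forall]
  exact MeasurableSet.iInter fun i => MeasurableSet.iInter fun hi =>
    (measurableSet_lt measurable_const (h i hi)).compl

end Measurability

section Probability

variable {Ω : Type*} {mΩ : MeasurableSpace Ω} {P : Measure Ω} {N : ℕ}
  {Z : Fin N → Ω → ℝ}

lemma measureReal_inter_of_disjoint_coordinates (hm : ∀ i, Measurable (Z i))
    (hind : iIndepFun Z P) {S T : Set (Fin N)} (hST : Disjoint S T) {U V : Set Ω}
    (hU : ∀ m : MeasurableSpace Ω, (∀ i ∈ S, Measurable[m] (Z i)) → MeasurableSet[m] U)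
    (hV : ∀ m : MeasurableSpace Ω, (∀ i ∈ T, Measurable[m] (Z i)) → MeasurableSet[m] V) :
    P.real (U ∩ V) = P.real U * P.real V := by
  have h := indep_iSup_of_disjoint (m := fun i => MeasurableSpace.comap (Z i) inferInstance)
    (fun i => (hm i).comap_le) hind hST
  have hcomap : ∀ R : Set (Fin N), ∀ i ∈ R,
      Measurable[⨆ i ∈ R, MeasurableSpace.comap (Z i) inferInstance] (Z i) := fun R i hi =>
    (comap_measurable (Z i)).mono (le_iSup₂_of_le i hi le_rfl) le_rfl
  rw [measureReal_def, (Indep_iff _ _ P).1 h _ _ (hU _ (hcomap S)) (hV _ (hcomap T)), ENNReal.toReal_mul]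
  rfl

variable [IsProbabilityMeasure P]

lemma measureReal_not_pos (hm : ∀ i, Measurable (Z i))
    (hlaw : ∀ i, P.map (Z i) = gaussianReal 0 1) (i : Fin N) :
    P.real {ω | ¬ 0 < Z i ω} = 1 / 2 := by
  have h := integral_indicator_exp_sq_gaussianReal (s := 0) (by norm_num)
  simp only [zero_mul, Real.exp_zero, sub_zero] at h
  rw [integral_indicator measurableSet_Ioi, setIntegral_const, smul_eq_mul, mul_one,
    div_self (by norm_num), Real.one_rpow, mul_one, ← hlaw i, map_measureReal_apply (hm i)
    measurableSet_Ioi] at h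
  have hc := probReal_compl_eq_one_sub (μ := P) (hm i (measurableSet_Ioi (a := (0 : ℝ))))
  rw [h] at hc
  rw [show {ω | ¬ 0 < Z i ω} = (Z i ⁻¹' Set.Ioi 0)ᶜ from rfl, hc]
  norm_num

lemma measureReal_runsLt_eq_sum (hm : ∀ i, Measurable (Z i)) (hind : iIndepFun Z P)
    (hlaw : ∀ i, P.map (Z i) = gaussianReal 0 1) {t : ℝ} {a : ℕ} (ha : a ≤ N) :
    P.real {ω | RunsLt t a fun i => Z i ω} = ∑ b ∈ Finset.Icc a N,
      P.real {ω | (∀ i ∈ finSegment N a b, 0 < Z i ω) ∧ ∑ i ∈ finSegment N a b, Z i ω ^ 2 < t} *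
        ((if b < N then 1 / 2 else 1) * P.real {ω | RunsLt t (b + 1) fun i => Z i ω}) := by
  set D : ℕ → Set Ω := fun b =>
    {ω | (∀ i ∈ finSegment N a b, 0 < Z i ω) ∧ ∑ i ∈ finSegment N a b, Z i ω ^ 2 < t} with hD
  set F : ℕ → Set Ω := fun b => {ω | ∀ i : Fin N, (i : ℕ) = b → ¬ 0 < Z i ω} with hF
  set G : ℕ → Set Ω := fun b => {ω | RunsLt t b fun i => Z i ω} with hG
  have hDm : ∀ b (m : MeasurableSpace Ω),
      (∀ i ∈ {i : Fin N | (i : ℕ) < b}, Measurable[m] (Z i)) → MeasurableSet[m] (D b) := by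
    intro b m h
    have h' : ∀ i ∈ finSegment N a b, Measurable (Z i) := fun i hi => h i (mem_finSegment.1 hi).2
    exact (measurableSet_forall_pos h').inter (measurableSet_sum_sq_lt h' t)
  have hFm : ∀ b (m : MeasurableSpace Ω),
      (∀ i ∈ {i : Fin N | (i : ℕ) = b}, Measurable[m] (Z i)) → MeasurableSet[m] (F b) :=
    fun b m h => measurableSet_not_pos_at h
  have hGm : ∀ b (m : MeasurableSpace Ω),
      (∀ i ∈ {i : Fin N | b ≤ (i : ℕ)}, Measurable[m] (Z i)) → MeasurableSet[m] (G b) :=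
    fun b m h => measurableSet_runsLt h t
  have hunion : G a = ⋃ b ∈ Finset.Icc a N, D b ∩ (F b ∩ G (b + 1)) := by
    ext ω
    simp only [Set.mem_iUnion, Finset.mem_Icc, exists_prop]
    constructor
    · intro h
      have hex : ∃ b, a ≤ b ∧ ∀ i : Fin N, (i : ℕ) = b → ¬ 0 < Z i ω :=
        ⟨N, ha, fun i hi => absurd i.2 (by omega)⟩
      classical
      have hspec := Nat.find_spec hex
      have hs : ∀ i ∈ finSegment N a (Nat.find hex), 0 < Z i ω := by
        intro i hi
        rw [mem_finSegment] at hi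
        by_contra hn
        exact Nat.find_min hex hi.2 ⟨hi.1, fun j hj => by rwa [Fin.ext hj]⟩
      have h2 := (runsLt_iff_of_first_failure hspec.1 hs hspec.2).1 h
      exact ⟨Nat.find hex, ⟨hspec.1, Nat.find_min' hex
        ⟨ha, fun i hi => absurd i.2 (by omega)⟩⟩, ⟨hs, h2.1⟩, hspec.2, h2.2⟩
    · rintro ⟨b, ⟨hab, _⟩, ⟨hs, hlt⟩, hf, hg⟩
      exact (runsLt_iff_of_first_failure hab hs hf).2 ⟨hlt, hg⟩
  have hdisj : ∀ b c, a ≤ b → b < c → c ≤ N →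
      Disjoint (D b ∩ (F b ∩ G (b + 1))) (D c ∩ (F c ∩ G (c + 1))) := by
    intro b c hab hbc hc
    rw [Set.disjoint_left]
    rintro ω ⟨_, hf, _⟩ ⟨hs, _⟩
    exact hf ⟨b, by omega⟩ rfl (hs.1 ⟨b, by omega⟩ (mem_finSegment.2 ⟨hab, hbc⟩))
  change P.real (G a) = ∑ b ∈ Finset.Icc a N,
    P.real (D b) * ((if b < N then 1 / 2 else 1) * P.real (G (b + 1)))
  rw [hunion, measureReal_biUnion_finset]
  · refine Finset.sum_congr rfl fun b hb => ?_
    rw [measureReal_inter_of_disjoint_coordinates hm hind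
      (S := {i : Fin N | (i : ℕ) < b}) (T := {i : Fin N | b ≤ (i : ℕ)}) ?_ (hDm b) ?_,
      measureReal_inter_of_disjoint_coordinates hm hind
      (S := {i : Fin N | (i : ℕ) = b}) (T := {i : Fin N | b + 1 ≤ (i : ℕ)}) ?_ (hFm b) (hGm _)]
    · congr 2
      split_ifs with hbN
      · rw [← measureReal_not_pos hm hlaw ⟨b, hbN⟩]
        congr 1
        ext ω
        simp only [hF, Set.mem_ofPred_eq]
        exact ⟨fun h => h _ rfl, fun h i hi => by rwa [show i = ⟨b, hbN⟩ from Fin.ext hi]⟩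
      · have : F b = Set.univ := Set.eq_univ_of_forall fun ω i hi => absurd i.2 (by omega)
        rw [this, probReal_univ]
    · rw [Set.disjoint_left]
      intro i hi hi'
      simp only [Set.mem_ofPred_eq] at hi hi'
      omega
    · rw [Set.disjoint_left]
      intro i hi hi'
      simp only [Set.mem_ofPred_eq] at hi hi'
      omega
    · intro m h
      exact (hFm b m fun i hi => h i (le_of_eq hi.symm)).inter
        (hGm (b + 1) m fun i hi => h i (Nat.le_of_succ_le hi))
  · intro b hb c hc hbc
    simp only [Finset.coe_Icc, Set.mem_Icc] at hb hc
    rcases lt_or_gt_of_ne hbc with h | h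
    · exact hdisj b c hb.1 h hc.2
    · exact (hdisj c b hc.1 h hb.2).symm
  · intro b _
    exact (hDm b _ fun i _ => hm i).inter ((hFm b _ fun i _ => hm i).inter (hGm _ _ fun i _ => hm i))

open Polynomial in
lemma measureReal_runsLt_eq_blockSum (hm : ∀ i, Measurable (Z i)) (hind : iIndepFun Z P)
    (hlaw : ∀ i, P.map (Z i) = gaussianReal 0 1) {t : ℝ} (ht : 0 < t) (m : ℕ) (hmN : m ≤ N) :
    P.real {ω | RunsLt t (N - m) fun i => Z i ω} = (1 / 2) ^ m *
      blockSum (1 + ∑ l ∈ Finset.Icc 1 N, monomial l (chiSqCDF l t)) (m + 1) := by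
  set F : ℝ[X] := 1 + ∑ l ∈ Finset.Icc 1 N, monomial l (chiSqCDF l t) with hF
  have hcoeff : ∀ k ≤ N, F.coeff k = if k = 0 then 1 else chiSqCDF k t := by
    intro k hk
    simp only [hF, coeff_add, coeff_one, finsetSum_coeff, coeff_monomial,
      Finset.sum_ite_eq', Finset.mem_Icc]
    split_ifs <;> first | omega | simp
  have hseg : ∀ a k, a + k ≤ N → P.real {ω | (∀ i ∈ finSegment N a (a + k), 0 < Z i ω) ∧
      ∑ i ∈ finSegment N a (a + k), Z i ω ^ 2 < t} = (1 / 2) ^ k * F.coeff k := by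
    intro a k hak
    have hcard : (finSegment N a (a + k)).card = k := by rw [card_finSegment hak]; omega
    rw [hcoeff k (by omega)]
    split_ifs with hk
    · have : finSegment N a (a + k) = ∅ := Finset.card_eq_zero.1 (hcard.trans hk)
      simp only [this]
      simp [ht, hk]
    · rw [measureReal_orthant_sum_sq_lt hm hind hlaw _ (by rw [hcard]; exact hk) ht, hcard, chiSqCDF]
  have hend : P.real {ω | RunsLt t (N + 1) fun i => Z i ω} = 1 := by
    have : {ω | RunsLt t (N + 1) fun i => Z i ω} = Set.univ :=
      Set.eq_univ_of_forall fun ω => runsLt_of_le ht (Nat.le_succ N) _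
    rw [this, probReal_univ]
  induction m using Nat.strong_induction_on with
  | _ m ih =>
    rw [measureReal_runsLt_eq_sum hm hind hlaw (Nat.sub_le N m), blockSum_succ,
      ← Finset.Ico_succ_right_eq_Icc, Finset.sum_Ico_eq_sum_range, Finset.mul_sum]
    rw [show Order.succ N - (N - m) = m + 1 by simp; omega]
    refine Finset.sum_congr rfl fun k hk => ?_
    have hk' : k ≤ m := Nat.lt_succ_iff.1 (Finset.mem_range.1 hk)
    rw [hseg _ k (by omega)]
    rcases hk'.lt_or_eq with hlt | rfl
    · rw [if_pos (by omega), show N - m + k + 1 = N - (m - k - 1) by omega,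
        ih (m - k - 1) (by omega) (by omega), show m - k - 1 + 1 = m - k by omega]
      obtain ⟨d, rfl⟩ : ∃ d, m = k + 1 + d := ⟨m - k - 1, by omega⟩
      rw [show k + 1 + d - k - 1 = d by omega, pow_add, pow_add]
      ring
    · rw [if_neg (by omega), show N - k + k + 1 = N + 1 by omega, hend, Nat.sub_self]
      simp [blockSum]

lemma measureReal_forall_not_pos (hm : ∀ i, Measurable (Z i)) (hind : iIndepFun Z P)
    (hlaw : ∀ i, P.map (Z i) = gaussianReal 0 1) :
    P.real {ω | ∀ i, ¬ 0 < Z i ω} = (1 / 2) ^ N := by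
  have h := hind.measure_inter_preimage_eq_mul Finset.univ (sets := fun _ => Set.Iic 0)
    (fun _ _ => measurableSet_Iic)
  have hset : {ω | ∀ i, ¬ 0 < Z i ω} = ⋂ i ∈ Finset.univ, Z i ⁻¹' Set.Iic 0 := by
    ext ω
    simp
  have hi : ∀ i, (P (Z i ⁻¹' Set.Iic 0)).toReal = 1 / 2 := by
    intro i
    rw [← measureReal_not_pos hm hlaw i, measureReal_def]
    congr 2
    ext ω
    simp
  rw [hset, measureReal_def, h, ENNReal.toReal_prod]
  simp [hi]

end Probability

lemma pi_gaussianReal_runs_weight_lt (N : ℕ) (μ : Fin N → ℝ) (σ : Fin N → ℝ)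
    (hσ : ∀ i, 0 < σ i)
    (v : Fin N → NNReal) (hv : ∀ i, (v i : ℝ) = σ i ^ 2) (t : ℝ) (ht : 0 < t) :
    (Measure.pi fun i => gaussianReal (μ i) (v i))
        {x : Fin N → ℝ | (∃ i, μ i < x i) ∧
          ∀ A : Finset (Fin N), IsSuccessRun (fun i => μ i < x i) A →
            ∑ i ∈ A, (x i - μ i) ^ 2 / (σ i) ^ 2 < t}
      = ENNReal.ofReal (((2 : ℝ) ^ N)⁻¹ *
          ∑ r ∈ Finset.Icc 1 N, ∑ M ∈ Finset.Icc 1 (min r (N - r + 1)),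
            ∑ π ∈ Finset.univ.filter (fun π : Nat.Partition r => Multiset.card π.parts = M),
              (∏ l ∈ Finset.Icc 1 r, chiSqCDF l t ^ (π.parts.count l))
                * Polynomial.eval ((N : ℝ) - r + 2 - M) (ascPochhammer ℝ M)
                / ∏ l ∈ Finset.Icc 1 r, (Nat.factorial (π.parts.count l) : ℝ)) := by
  set P := Measure.pi fun i => gaussianReal (μ i) (v i) with hP
  let Z : Fin N → (Fin N → ℝ) → ℝ := fun i x => (x i - μ i) / σ i
  have hm : ∀ i, Measurable (Z i) := fun i => by fun_prop
  have hind : iIndepFun Z P :=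
    iIndepFun_pi (X := fun i y => (y - μ i) / σ i) fun i => by fun_prop
  have hlaw : ∀ i, P.map (Z i) = gaussianReal 0 1 := by
    intro i
    have h1 : P.map (fun x => x i) = gaussianReal (μ i) (v i) :=
      (measurePreserving_eval _ i).map_eq
    have h2 : P.map (Z i) = ((P.map fun x => x i).map fun y => y - μ i).map fun y => y / σ i := by
      rw [Measure.map_map (by fun_prop) (by fun_prop), Measure.map_map (by fun_prop) (by fun_prop)]
      rfl
    rw [h2, h1, gaussianReal_map_sub_const, gaussianReal_map_div_const, sub_self, zero_div]
    congr 1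
    have h0 : v i ≠ 0 := fun h => (pow_pos (hσ i) 2).ne' (by rw [← hv i, h]; rfl)
    rw [← div_self h0]
    congr 1
    exact NNReal.eq (hv i).symm
  have hpos : ∀ x i, 0 < Z i x ↔ μ i < x i := fun x i => by
    simp only [Z]
    rw [div_pos_iff_of_pos_right (hσ i), sub_pos]
  have hset : {x : Fin N → ℝ | (∃ i, μ i < x i) ∧
      ∀ A : Finset (Fin N), IsSuccessRun (fun i => μ i < x i) A →
        ∑ i ∈ A, (x i - μ i) ^ 2 / (σ i) ^ 2 < t} =
      {x | RunsLt t 0 fun i => Z i x} \ {x | ∀ i, ¬ 0 < Z i x} := by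
    ext x
    rw [Set.mem_sdiff, Set.mem_ofPred_eq, Set.mem_ofPred_eq, Set.mem_ofPred_eq,
      ← forall_isSuccessRun_iff_runsLt ht]
    simp only [hpos]
    simp only [Z, div_pow]
    push Not
    exact and_comm
  have hsub : {x | ∀ i, ¬ 0 < Z i x} ⊆ {x | RunsLt t 0 fun i => Z i x} := by
    intro x hx B _ hB _
    have : B = ∅ := Finset.eq_empty_of_forall_notMem fun i hi => hx i (hB i hi)
    simpa [this] using ht
  have hmeas : MeasurableSet {x | ∀ i, ¬ 0 < Z i x} := by
    simp only [Set.ofPred_forall]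
    exact MeasurableSet.iInter fun i => (measurableSet_lt measurable_const (hm i)).compl
  have hmain := measureReal_runsLt_eq_blockSum hm hind hlaw ht N le_rfl
  rw [Nat.sub_self] at hmain
  rw [hset, ← ofReal_measureReal, measureReal_sdiff hsub hmeas, hmain,
    measureReal_forall_not_pos hm hind hlaw, blockSum_one_add]
  congr 1
  rw [one_div, inv_pow]
  ring

/-- Let `X₁, …, X_N` (`N ≥ 1`) be independent with `Xᵢ ~ N(μᵢ, σᵢ²)`, `σᵢ > 0` (the
underlying measure being the product of the `N` Gaussian measures on `ℝ^N`). Index `i` is a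
success if `Xᵢ > μᵢ`; each success run `A` (maximal block of consecutive success indices)
has weight `χ²_run(A) = ∑_{i ∈ A} (Xᵢ - μᵢ)²/σᵢ²`, and `T` is the largest weight of a
success run. For every real `t > 0`, the probability that at least one success occurs and
`T < t` (i.e. every success run has weight `< t`) equals
`2^{-N} ∑_{r=1}^N ∑_{M=1}^{min(r,N-r+1)} ∑_π [∏_l F_l(t)^{n_l}] (N-r+2-M)_M / ∏_l n_l!`,
the inner sum over partitions `π` of `r` into exactly `M` parts, `n_l` the number of parts
of `π` equal to `l`, `(x)_n` the ascending Pochhammer symbol and `F_l` the chi-squared CDF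
with `l` degrees of freedom. -/
theorem prob_max_run_weight_lt (N : ℕ) (hN : 1 ≤ N) (μ : Fin N → ℝ) (σ : Fin N → ℝ)
    (hσ : ∀ i, 0 < σ i) (t : ℝ) (ht : 0 < t) :
    (Measure.pi fun i => gaussianReal (μ i) ⟨(σ i) ^ 2, sq_nonneg _⟩)
        {x : Fin N → ℝ | (∃ i, μ i < x i) ∧
          ∀ A : Finset (Fin N), IsSuccessRun (fun i => μ i < x i) A →
            ∑ i ∈ A, (x i - μ i) ^ 2 / (σ i) ^ 2 < t}
      = ENNReal.ofReal (((2 : ℝ) ^ N)⁻¹ *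
          ∑ r ∈ Finset.Icc 1 N, ∑ M ∈ Finset.Icc 1 (min r (N - r + 1)),
            ∑ π ∈ Finset.univ.filter (fun π : Nat.Partition r => Multiset.card π.parts = M),
              (∏ l ∈ Finset.Icc 1 r, chiSqCDF l t ^ (π.parts.count l))
                * Polynomial.eval ((N : ℝ) - r + 2 - M) (ascPochhammer ℝ M)
                / ∏ l ∈ Finset.Icc 1 r, (Nat.factorial (π.parts.count l) : ℝ)) := by
  exact pi_gaussianReal_runs_weight_lt N μ σ hσ _ (fun _ => rfl) t ht
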